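/- Let m ≥ 2 and consider the MERW transition matrix P^M on the rose graph R_m^4: P^M(0, 3p+1) = P^M(0, 3p+2) = 1/(2m); P^M(3p+1, 0) = P^M(3p+2, 0) = m/(m+1); P^M(3p+1, 3p+3) = P^M(3p+2, 3p+3) = 1/(m+1); P^M(3p+3, 3p+1) = P^M(3p+3, 3p+2) = 1/2 for every p ∈ {0,…,m−1}, and all other entries 0. Define π by π(0) = m/(2m+2), π(i) = 1/(4m) for each internal node i, and π(j) = 1/(2m(m+1)) for each peripheral node j. Then π is a probability vector (all entries positive and summing to 1) and π P^M = π; that is, π is the stationary distribution of the MERW on R_m^4. -/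

import Mathlib

open Finset
/-- Transition matrix of the maximal entropy random walk (MERW) on the rose graph
`R_m^4`: from the hub (vertex `0`) probability `1/(2m)` to each internal node; from each
internal node probability `m/(m+1)` to the hub and `1/(m+1)` to its peripheral neighbor;
from each peripheral node probability `1/2` to each of its two internal neighbors. -/
noncomputable def rosePM (m : ℕ) : Matrix (Fin (3 * m + 1)) (Fin (3 * m + 1)) ℝ :=
  fun i j =>
    if (i : ℕ) = 0 ∧ (j : ℕ) % 3 ≠ 0 then 1 / (2 * (m : ℝ))
    else if (i : ℕ) % 3 ≠ 0 ∧ (j : ℕ) = 0 then (m : ℝ) / ((m : ℝ) + 1)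
    else if ((i : ℕ) % 3 = 1 ∧ (j : ℕ) = (i : ℕ) + 2)
        ∨ ((i : ℕ) % 3 = 2 ∧ (j : ℕ) = (i : ℕ) + 1) then 1 / ((m : ℝ) + 1)
    else if (i : ℕ) % 3 = 0 ∧ (i : ℕ) ≠ 0
        ∧ ((j : ℕ) + 2 = (i : ℕ) ∨ (j : ℕ) + 1 = (i : ℕ)) then 1 / 2
    else 0

/-- A sum over the vertices of the rose graph splits into the hub and the `m` petals. -/
theorem sum_univ_hub_add_petals {M : Type*} [AddCommMonoid M] (m : ℕ)
    (f : Fin (3 * m + 1) → M) :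
    ∑ i, f i = f 0 + ∑ p : Fin m, (f ⟨3 * p + 1, by omega⟩ + f ⟨3 * p + 2, by omega⟩
      + f ⟨3 * p + 3, by omega⟩) := by
  induction m with
  | zero => simp
  | succ m ih =>
    rw [Fin.sum_univ_castSucc (n := m)]
    change ∑ i : Fin (3 * m + 1 + 1 + 1 + 1), f i = _
    rw [Fin.sum_univ_castSucc, Fin.sum_univ_castSucc, Fin.sum_univ_castSucc, ih]
    simp only [add_assoc]
    rfl

/-- Every vertex of the rose graph is the hub or one of the three other vertices of a petal. -/
theorem eq_hub_or_mem_petal {m : ℕ} (j : Fin (3 * m + 1)) :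
    (j : ℕ) = 0 ∨ ∃ q : Fin m, (j : ℕ) = 3 * q + 1 ∨ (j : ℕ) = 3 * q + 2 ∨
      (j : ℕ) = 3 * q + 3 := by
  rcases Nat.eq_zero_or_pos (j : ℕ) with h | h
  · exact Or.inl h
  · refine Or.inr ⟨⟨((j : ℕ) - 1) / 3, by omega⟩, ?_⟩
    dsimp only
    omega

/-- Stationary distribution of the MERW on the rose graph `R_m^4`: the vector with value
`m/(2m+2)` at the hub, `1/(4m)` at each internal node, and `1/(2m(m+1))` at each
peripheral node is a probability vector fixed by the MERW transition matrix. -/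
theorem rose_merw_stationary (m : ℕ) (hm : 2 ≤ m)
    (pvec : Fin (3 * m + 1) → ℝ)
    (hpvec : ∀ i, pvec i =
      if (i : ℕ) = 0 then (m : ℝ) / (2 * (m : ℝ) + 2)
      else if (i : ℕ) % 3 ≠ 0 then 1 / (4 * (m : ℝ))
      else 1 / (2 * (m : ℝ) * ((m : ℝ) + 1))) :
    (∀ i, 0 < pvec i) ∧ (∑ i, pvec i) = 1 ∧
      ∀ j, (∑ i, pvec i * rosePM m i j) = pvec j := by
  have hm0 : (0 : ℝ) < m := by exact_mod_cast (by omega : 0 < m)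
  have hub : pvec 0 = (m : ℝ) / (2 * (m : ℝ) + 2) := by simp [hpvec]
  have internal_one (p : Fin m) (h) : pvec ⟨3 * p + 1, h⟩ = 1 / (4 * (m : ℝ)) := by
    rw [hpvec, if_neg (by dsimp only; omega), if_pos (by dsimp only; omega)]
  have internal_two (p : Fin m) (h) : pvec ⟨3 * p + 2, h⟩ = 1 / (4 * (m : ℝ)) := by
    rw [hpvec, if_neg (by dsimp only; omega), if_pos (by dsimp only; omega)]
  have peripheral (p : Fin m) (h) :
      pvec ⟨3 * p + 3, h⟩ = 1 / (2 * (m : ℝ) * ((m : ℝ) + 1)) := by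
    rw [hpvec, if_neg (by dsimp only; omega), if_neg (by dsimp only; omega)]
  refine ⟨fun i => ?_, ?_, fun j => ?_⟩
  · rw [hpvec]
    split_ifs <;> positivity
  · simp only [sum_univ_hub_add_petals, hub, internal_one, internal_two, peripheral,
      sum_const, card_univ, Fintype.card_fin, nsmul_eq_mul]
    field_simp
    ring
  · rw [sum_univ_hub_add_petals]
    simp only [hub, internal_one, internal_two, peripheral]
    rcases eq_hub_or_mem_petal j with hj | ⟨q, hj⟩
    · obtain rfl : j = 0 := Fin.ext hj
      have row_hub : rosePM m 0 0 = 0 := by simp [rosePM]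
      have row_one (p : Fin m) (h) : rosePM m ⟨3 * p + 1, h⟩ 0 = (m : ℝ) / (m + 1) := by
        simp [rosePM, Nat.add_mod]
      have row_two (p : Fin m) (h) : rosePM m ⟨3 * p + 2, h⟩ 0 = (m : ℝ) / (m + 1) := by
        simp [rosePM, Nat.add_mod]
      have row_peripheral (p : Fin m) (h) : rosePM m ⟨3 * p + 3, h⟩ 0 = 0 := by
        simp [rosePM]
      simp only [row_hub, row_one, row_two, row_peripheral, hub, sum_const, card_univ,
        Fintype.card_fin, nsmul_eq_mul]
      field_simp
      ring
    · have row_hub : rosePM m 0 j = if (j : ℕ) % 3 = 0 then 0 else 1 / (2 * (m : ℝ)) := by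
        unfold rosePM
        grind
      have row_one (p : Fin m) (h) : rosePM m ⟨3 * p + 1, h⟩ j =
          if p = q then if (j : ℕ) % 3 = 0 then 1 / ((m : ℝ) + 1) else 0 else 0 := by
        simp only [rosePM, Fin.ext_iff]
        grind
      have row_two (p : Fin m) (h) : rosePM m ⟨3 * p + 2, h⟩ j =
          if p = q then if (j : ℕ) % 3 = 0 then 1 / ((m : ℝ) + 1) else 0 else 0 := by
        simp only [rosePM, Fin.ext_iff]
        grind
      have row_peripheral (p : Fin m) (h) : rosePM m ⟨3 * p + 3, h⟩ j =
          if p = q then if (j : ℕ) % 3 = 0 then 0 else 1 / 2 else 0 := by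
        simp only [rosePM, Fin.ext_iff]
        clear row_hub row_one row_two hpvec hub internal_one internal_two peripheral
        grind (splits := 20)
      simp only [row_hub, row_one, row_two, row_peripheral, hpvec j,
        if_neg (by omega : (j : ℕ) ≠ 0), mul_ite, mul_zero, sum_add_distrib, sum_ite_eq',
        mem_univ, if_true]
      by_cases h : (j : ℕ) % 3 = 0
      · simp only [h, if_true, ne_eq, not_true_eq_false, if_false]
        field_simp
        ring
      · simp only [h, if_false, ne_eq, not_false_eq_true, if_true]
        field_simp
        ring
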